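/- Let q be a prime with q ≡ 1 (mod 4), let g ≥ 0, and let f be a monic polynomial in F_q[x]. Then Σ_{D ∈ H_{2g+1}} χ_f(D) = Σ_{C | f^∞} Σ_{h ∈ M_{2g+1−2d(C)}} χ_f(h) − q · Σ_{C | f^∞} Σ_{h ∈ M_{2g−1−2d(C)}} χ_f(h), where the sums over C run over all monic polynomials C all of whose monic irreducible factors divide f, and M_m is empty when m < 0. -/

import Mathlib

/- Setting: `F_q[x]` with `q` prime, `q ≡ 1 (mod 4)`.  `M_n` denotes the monic
polynomials of degree `n`, `M_{≤n}` those of degree at most `n`, `H_n` the monic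
squarefree polynomials of degree `n`. -/

open Polynomial

noncomputable section

attribute [local instance] Classical.propDecidable

abbrev Fqx (q : ℕ) := Polynomial (ZMod q)

/-- The (sub)type of monic irreducible polynomials over `F_q`. -/
abbrev MIrr (q : ℕ) := {P : Fqx q // P.Monic ∧ Irreducible P}

/-- The norm `|f| = q ^ deg f`, as a complex number. -/
def nm (q : ℕ) (f : Fqx q) : ℂ := (q : ℂ) ^ f.natDegree

/-- The monic polynomial `X ^ n + ∑ i < n, c i * X ^ i` of degree `n`; as `c` runs over
`Fin n → ZMod q`, this enumerates the monic polynomials of degree `n` exactly once. -/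
def monicOf (q n : ℕ) (c : Fin n → ZMod q) : Fqx q :=
  X ^ n + ∑ i : Fin n, C (c i) * X ^ (i : ℕ)

/-- The polynomial `∑ i < n, c i * X ^ i` of degree `< n`; as `c` runs over
`Fin n → ZMod q`, this enumerates the residues modulo a polynomial of degree `n`. -/
def polyOf (q n : ℕ) (c : Fin n → ZMod q) : Fqx q :=
  ∑ i : Fin n, C (c i) * X ^ (i : ℕ)

/-- The sum of `F` over the monic polynomials of degree `n` (empty if `n < 0`). -/
def sumMn (q : ℕ) [NeZero q] (n : ℤ) (F : Fqx q → ℂ) : ℂ :=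
  if 0 ≤ n then ∑ c : Fin n.toNat → ZMod q, F (monicOf q n.toNat c) else 0

/-- The sum of `F` over the monic polynomials of degree at most `n` (empty if `n < 0`). -/
def sumMle (q : ℕ) [NeZero q] (n : ℤ) (F : Fqx q → ℂ) : ℂ :=
  ∑ m ∈ Finset.range (n + 1).toNat, sumMn q m F

/-- The sum of `F` over `H_n`, the monic squarefree polynomials of degree `n`. -/
def sumH (q : ℕ) [NeZero q] (n : ℕ) (F : Fqx q → ℂ) : ℂ :=
  ∑ c : Fin n → ZMod q,
    if Squarefree (monicOf q n c) then F (monicOf q n c) else 0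

/-- The quadratic residue symbol `(f | P)` for `P` monic irreducible:  it is `0` if
`P ∣ f`, `1` if `P ∤ f` and `f` is a square modulo `P`, and `-1` otherwise. -/
def legSym (q : ℕ) (f P : Fqx q) : ℤ :=
  if P ∣ f then 0 else if ∃ g : Fqx q, P ∣ (g ^ 2 - f) then 1 else -1

/-- The Jacobi symbol `(f | u)`, extending the quadratic residue symbol
multiplicatively in the lower entry. -/
def jacSym (q : ℕ) [Fact q.Prime] (f u : Fqx q) : ℤ :=
  if u = 0 then (if IsUnit f then 1 else 0)
  else ((UniqueFactorizationMonoid.factors u).map fun P => legSym q f P).prod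

/-- The character `χ_D(f) = (D | f)`, as a complex number. -/
def chi (q : ℕ) [Fact q.Prime] (D f : Fqx q) : ℂ := jacSym q D f

/-- `d_k(f)`: the number of ways of writing `f` as an ordered product of `k` monic
polynomials. -/
def dk (q k : ℕ) (f : Fqx q) : ℕ :=
  Nat.card {t : Fin k → Fqx q // (∀ i, (t i).Monic) ∧ ∏ i, t i = f}

/-- The exponential `e(a/f) = exp(2πi a₁/q)`, where `a₁ ∈ F_q ≅ ℤ/q` is the coefficient
of `1/x` in the Laurent expansion of `a/f` at infinity, i.e. the coefficient of
`x^(deg f - 1)` in `a mod f`. -/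
def eQ (q : ℕ) (f a : Fqx q) : ℂ :=
  Complex.exp (2 * (Real.pi : ℂ) * Complex.I * (((a %ₘ f).coeff (f.natDegree - 1)).val : ℂ) / q)

/-- The generalized Gauss sum `G(V, χ_f) = ∑_{u mod f} χ_f(u) e(uV/f)`. -/
def gSum (q : ℕ) [Fact q.Prime] (V f : Fqx q) : ℂ :=
  ∑ c : Fin f.natDegree → ZMod q,
    chi q f (polyOf q f.natDegree c) * eQ q f (polyOf q f.natDegree c * V)

/-- `L(1/2, χ_D)`: since `L(s, χ_D) = ∑_{f ∈ M} χ_D(f) |f|^{-s}` is a polynomial of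
degree `deg D - 1` in `q^{-s}` (for `D` squarefree of odd degree), this is the finite
sum `∑_{n < deg D} (∑_{f ∈ M_n} χ_D(f)) q^{-n/2}`. -/
def Lhalf (q : ℕ) [Fact q.Prime] (D : Fqx q) : ℂ :=
  ∑ n ∈ Finset.range D.natDegree,
    sumMn q n (fun f => chi q D f) / (Real.sqrt ((q : ℝ) ^ n) : ℂ)

/-- The L-series `L(w, χ_V) = ∑_{f ∈ M} χ_V(f) w^(deg f)`. -/
def Lser (q : ℕ) [Fact q.Prime] (V : Fqx q) (w : ℂ) : ℂ :=
  ∑' f : {f : Fqx q // f.Monic}, chi q V f.1 * w ^ f.1.natDegree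

/-- The Euler phi function: the number of units in `F_q[x]/(f)`. -/
def polyPhi (q : ℕ) [Fact q.Prime] (f : Fqx q) : ℕ :=
  Nat.card ((Fqx q ⧸ Ideal.span {f}))ˣ

/-- `Z(u) = (1 - qu)⁻¹`. -/
def Zf (q : ℕ) (u : ℂ) : ℂ := (1 - q * u)⁻¹

/-- The Euler product `B(u) = ∏_P (1 + u^d(u^d - 3)/((|P|+1)(1+u^d)))`, `d = d(P)`. -/
def Bfun (q : ℕ) (u : ℂ) : ℂ :=
  ∏' P : MIrr q, (1 + u ^ P.1.natDegree * (u ^ P.1.natDegree - 3) /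
    ((nm q P.1 + 1) * (1 + u ^ P.1.natDegree)))

/-- The Euler product `B_3(u)` from the third-moment main term. -/
def B3fun (q : ℕ) (u : ℂ) : ℂ :=
  ∏' P : MIrr q,
    (1 - (6 * u ^ P.1.natDegree - (15 - 6 * nm q P.1) * u ^ (2 * P.1.natDegree)
      + (20 - 8 * nm q P.1) * u ^ (3 * P.1.natDegree)
      - (15 - 3 * nm q P.1) * u ^ (4 * P.1.natDegree)
      + 6 * u ^ (5 * P.1.natDegree) - u ^ (6 * P.1.natDegree)) / (nm q P.1 + 1))

/-- `∑_{C ∈ M_{≤ g-1}, C | f^∞} |C|⁻²`, where `C | f^∞` means that every monic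
irreducible factor of `C` divides `f`. -/
def sumCdiv (q : ℕ) [NeZero q] (g : ℕ) (f : Fqx q) : ℂ :=
  sumMle q ((g : ℤ) - 1) fun Cp =>
    if ∀ P : Fqx q, P.Monic → Irreducible P → P ∣ Cp → P ∣ f
    then ((q : ℂ) ^ (2 * Cp.natDegree))⁻¹ else 0

/-- The main term `q^(2g+1) (1 - 1/q) ∑_{f ∈ M_{≤N}, f = □} d_k(f) φ(f) |f|^{-3/2}
∑_{C ∈ M_{≤g-1}, C|f^∞} |C|⁻²`. -/
def Mterm (q : ℕ) [Fact q.Prime] (k : ℕ) (N : ℤ) (g : ℕ) : ℂ :=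
  (q : ℂ) ^ (2 * g + 1) * (1 - 1 / q) * sumMle q N fun f =>
    if IsSquare f then
      (dk q k f : ℂ) * polyPhi q f / (Real.sqrt ((q : ℝ) ^ (3 * f.natDegree)) : ℂ)
        * sumCdiv q g f
    else 0

/-- The secondary main term `S_{kg}(V = □)` (with `N = kg` or `kg - 1`). -/
def Ssq (q : ℕ) [Fact q.Prime] (k : ℕ) (N : ℤ) (g : ℕ) : ℂ :=
  (q : ℂ) ^ (2 * g + 1) * sumMle q N fun f =>
    if Even f.natDegree then
      (dk q k f : ℂ) / (Real.sqrt ((q : ℝ) ^ (3 * f.natDegree)) : ℂ) *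
        sumMle q ((g : ℤ) - 1) (fun Cp =>
          if ∀ P : Fqx q, P.Monic → Irreducible P → P ∣ Cp → P ∣ f then
            ((q : ℂ) ^ (2 * Cp.natDegree))⁻¹ *
              ((q - 1) * sumMle q ((f.natDegree : ℤ) / 2 - g - 2 + Cp.natDegree)
                  (fun l => gSum q (l ^ 2) f)
                - sumMn q ((f.natDegree : ℤ) / 2 - g - 1 + Cp.natDegree)
                    (fun l => gSum q (l ^ 2) f)
                - (q - 1) / q * sumMle q ((f.natDegree : ℤ) / 2 - g - 1 + Cp.natDegree)
                    (fun l => gSum q (l ^ 2) f)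
                + (1 / q) * sumMn q ((f.natDegree : ℤ) / 2 - g + Cp.natDegree)
                    (fun l => gSum q (l ^ 2) f))
          else 0)
    else 0

/-- The odd-degree part `S_{kg,o}` (with `N = kg` or `kg - 1`). -/
def Sodd (q : ℕ) [Fact q.Prime] (k : ℕ) (N : ℤ) (g : ℕ) : ℂ :=
  (q : ℂ) ^ (2 * g + 1) * (Real.sqrt q : ℂ) * sumMle q N fun f =>
    if Odd f.natDegree then
      (dk q k f : ℂ) / (Real.sqrt ((q : ℝ) ^ (3 * f.natDegree)) : ℂ) *
        sumMle q ((g : ℤ) - 1) (fun Cp =>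
          if ∀ P : Fqx q, P.Monic → Irreducible P → P ∣ Cp → P ∣ f then
            ((q : ℂ) ^ (2 * Cp.natDegree))⁻¹ *
              (sumMn q ((f.natDegree : ℤ) - 2 * g - 2 + 2 * Cp.natDegree)
                  (fun V => gSum q V f)
                - (1 / q) * sumMn q ((f.natDegree : ℤ) - 2 * g + 2 * Cp.natDegree)
                    (fun V => gSum q V f))
          else 0)
    else 0

/-- The even-degree, non-square-`V` part `S_{kg,e}(V ≠ □)` (with `N = kg` or `kg-1`). -/
def SevNS (q : ℕ) [Fact q.Prime] (k : ℕ) (N : ℤ) (g : ℕ) : ℂ :=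
  (q : ℂ) ^ (2 * g + 1) * sumMle q N fun f =>
    if Even f.natDegree then
      (dk q k f : ℂ) / (Real.sqrt ((q : ℝ) ^ (3 * f.natDegree)) : ℂ) *
        sumMle q ((g : ℤ) - 1) (fun Cp =>
          if ∀ P : Fqx q, P.Monic → Irreducible P → P ∣ Cp → P ∣ f then
            ((q : ℂ) ^ (2 * Cp.natDegree))⁻¹ *
              ((q - 1) * sumMle q ((f.natDegree : ℤ) - 2 * g - 3 + 2 * Cp.natDegree)
                  (fun V => if IsSquare V then 0 else gSum q V f)
                - sumMn q ((f.natDegree : ℤ) - 2 * g - 2 + 2 * Cp.natDegree)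
                    (fun V => if IsSquare V then 0 else gSum q V f)
                - (q - 1) / q * sumMle q ((f.natDegree : ℤ) - 2 * g - 1 + 2 * Cp.natDegree)
                    (fun V => if IsSquare V then 0 else gSum q V f)
                + (1 / q) * sumMn q ((f.natDegree : ℤ) - 2 * g + 2 * Cp.natDegree)
                    (fun V => if IsSquare V then 0 else gSum q V f))
          else 0)
    else 0

/-- `∏_{P | f} (1 - |P|⁻² z^{-d(P)})`, a finite product written as a `tprod`. -/
def prodC (q : ℕ) (z : ℂ) (f : Fqx q) : ℂ :=
  ∏' P : {P : Fqx q // P.Monic ∧ Irreducible P ∧ P ∣ f},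
    (1 - 1 / (nm q P.1 ^ 2 * z ^ P.1.natDegree))

/-- `M(V; z, w) = ∑_{f ∈ M} d₂(f) G(V,χ_f) / (√|f| ∏_{P|f}(1 - |P|⁻²z^{-d(P)})) w^(deg f)`. -/
def Mser (q : ℕ) [Fact q.Prime] (V : Fqx q) (z w : ℂ) : ℂ :=
  ∑' f : {f : Fqx q // f.Monic},
    (dk q 2 f.1 : ℂ) * gSum q V f.1 /
      ((Real.sqrt ((q : ℝ) ^ f.1.natDegree) : ℂ) * prodC q z f.1) * w ^ f.1.natDegree

/-- The local factor `M_P(V; z, w)`. -/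
def MPf (q : ℕ) [Fact q.Prime] (V : Fqx q) (z w : ℂ) (P : Fqx q) : ℂ :=
  if P ∣ V then
    1 + (1 - 1 / (nm q P ^ 2 * z ^ P.natDegree))⁻¹ *
      ∑' b : ℕ, (dk q 2 (P ^ (b + 1)) : ℂ) * gSum q V (P ^ (b + 1)) /
        (Real.sqrt ((q : ℝ) ^ ((b + 1) * P.natDegree)) : ℂ) * w ^ ((b + 1) * P.natDegree)
  else
    1 + 2 * (jacSym q V P : ℂ) * w ^ P.natDegree / (nm q P ^ 2 * z ^ P.natDegree - 1)
      + w ^ (2 * P.natDegree)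
      - 4 * w ^ (2 * P.natDegree) / (1 - 1 / (nm q P ^ 2 * z ^ P.natDegree))
      + 2 * (jacSym q V P : ℂ) * w ^ (3 * P.natDegree) /
          (1 - 1 / (nm q P ^ 2 * z ^ P.natDegree))

/-- The local factor `R_P(l²; z, w)`. -/
def RPf (q : ℕ) [Fact q.Prime] (l : Fqx q) (z w : ℂ) (P : Fqx q) : ℂ :=
  if P ∣ l then
    (1 - w ^ P.natDegree) ^ 2 *
      (1 + (1 - 1 / (nm q P ^ 2 * z ^ P.natDegree))⁻¹ *
        ∑' b : ℕ, (dk q 2 (P ^ (b + 1)) : ℂ) * gSum q (l ^ 2) (P ^ (b + 1)) /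
          (Real.sqrt ((q : ℝ) ^ ((b + 1) * P.natDegree)) : ℂ) * w ^ ((b + 1) * P.natDegree))
  else
    1 + 2 * w ^ P.natDegree / (nm q P ^ 2 * z ^ P.natDegree - 1)
      + w ^ (2 * P.natDegree)
      - 4 * w ^ (2 * P.natDegree) / (1 - 1 / (nm q P ^ 2 * z ^ P.natDegree))
      + 2 * w ^ (3 * P.natDegree) / (1 - 1 / (nm q P ^ 2 * z ^ P.natDegree))

/-- `R(z, w) = ∑_{l ∈ M} z^(deg l) ∏_P R_P(l²; z, w)`. -/
def Rser (q : ℕ) [Fact q.Prime] (z w : ℂ) : ℂ :=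
  ∑' l : {l : Fqx q // l.Monic}, z ^ l.1.natDegree * ∏' P : MIrr q, RPf q l.1 z w P.1

/-- The local factor `F_P(z, w)`. -/
def FPf (q : ℕ) (z w : ℂ) (P : Fqx q) : ℂ :=
  (1 - w ^ P.natDegree) ^ 2 *
    (1 - (1 - 2 * nm q P ^ 2 * (w * z) ^ P.natDegree - 2 * nm q P * (w ^ 2 * z) ^ P.natDegree
        + 2 * nm q P ^ 2 * (w * z ^ 2) ^ P.natDegree
        + (-2 * nm q P ^ 3 + 3 * nm q P ^ 2) * (w ^ 2 * z ^ 2) ^ P.natDegree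
        + nm q P ^ 2 * (w ^ 4 * z ^ 2) ^ P.natDegree
        - nm q P ^ 3 * (w ^ 4 * z ^ 3) ^ P.natDegree) /
      (nm q P ^ 2 * z ^ P.natDegree * (1 - nm q P * w ^ (2 * P.natDegree) * z ^ P.natDegree)))

/-- `F(z, w) = ∏_P F_P(z, w)`. -/
def Ffull (q : ℕ) (z w : ℂ) : ℂ := ∏' P : MIrr q, FPf q z w P.1

/-- `F(z) = F(z, 1/q)`. -/
def Fone (q : ℕ) (z : ℂ) : ℂ := Ffull q z (1 / q)

/-- `α(z) = (1/q) ∂_w F(z, w)|_{w = 1/q} / F(z, 1/q)`. -/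
def alphaF (q : ℕ) (z : ℂ) : ℂ := (1 / (q : ℂ)) * deriv (Ffull q z) (1 / q) / Fone q z

/-- The explicit formula for `F(z)`:
`∏_P (1 - 1/|P|)² (1 + 2/|P| + 1/|P|³ - (z^d + z^{-d})/|P|²)`. -/
def Fexp (q : ℕ) (z : ℂ) : ℂ :=
  ∏' P : MIrr q,
    ((1 - 1 / nm q P.1) ^ 2 *
      (1 + 2 / nm q P.1 + 1 / nm q P.1 ^ 3 -
        (z ^ P.1.natDegree + z⁻¹ ^ P.1.natDegree) / nm q P.1 ^ 2))

/-- The explicit formula for `α(z)`. -/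
def alphaExp (q : ℕ) (z : ℂ) : ℂ :=
  ∑' P : MIrr q,
    2 * (P.1.natDegree : ℂ) *
      (nm q P.1 ^ 2 + z ^ P.1.natDegree * (-3 * nm q P.1 ^ 3 - 3 * nm q P.1 + nm q P.1 ^ 2)
        + z ^ (2 * P.1.natDegree) * (nm q P.1 ^ 4 - nm q P.1 ^ 3 + 4 * nm q P.1 ^ 2 - nm q P.1 + 2)
        + z ^ (3 * P.1.natDegree) * (nm q P.1 ^ 2 - 2 * nm q P.1)) /
      ((nm q P.1 - 1) * (z ^ P.1.natDegree - nm q P.1) *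
        (nm q P.1 - z ^ P.1.natDegree - 2 * nm q P.1 ^ 2 * z ^ P.1.natDegree
          - nm q P.1 ^ 3 * z ^ P.1.natDegree + nm q P.1 * z ^ (2 * P.1.natDegree)))

/-- `A(V; z, w) = ∑_{f ∈ M} w^(deg f) d₃(f) G(V,χ_f)/(√|f| ∏_{P|f}(1 - |P|⁻²z^{-d(P)}))`. -/
def Aser (q : ℕ) [Fact q.Prime] (V : Fqx q) (z w : ℂ) : ℂ :=
  ∑' f : {f : Fqx q // f.Monic},
    w ^ f.1.natDegree * (dk q 3 f.1 : ℂ) * gSum q V f.1 /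
      ((Real.sqrt ((q : ℝ) ^ f.1.natDegree) : ℂ) * prodC q z f.1)

/-- The local factor `H_P(V; z, w)` of `A(V; z, w)`. -/
def HP3f (q : ℕ) [Fact q.Prime] (V : Fqx q) (z w : ℂ) (P : Fqx q) : ℂ :=
  if P ∣ V then
    1 + (1 - 1 / (nm q P ^ 2 * z ^ P.natDegree))⁻¹ *
      ∑' i : ℕ, w ^ ((i + 1) * P.natDegree) * (dk q 3 (P ^ (i + 1)) : ℂ) *
        gSum q V (P ^ (i + 1)) / (Real.sqrt ((q : ℝ) ^ ((i + 1) * P.natDegree)) : ℂ)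
  else
    1 + 3 * (jacSym q V P : ℂ) * w ^ P.natDegree / (nm q P ^ 2 * z ^ P.natDegree - 1)
      + 3 * w ^ (2 * P.natDegree)
      - 9 * w ^ (2 * P.natDegree) / (1 - 1 / (nm q P ^ 2 * z ^ P.natDegree))
      - (jacSym q V P : ℂ) * w ^ (3 * P.natDegree)
      + 9 * (jacSym q V P : ℂ) * w ^ (3 * P.natDegree) /
          (1 - 1 / (nm q P ^ 2 * z ^ P.natDegree))
      - 3 * w ^ (4 * P.natDegree) / (1 - 1 / (nm q P ^ 2 * z ^ P.natDegree))

/-- The local factor `A_P(l²; z, w)`. -/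
def APf (q : ℕ) [Fact q.Prime] (l : Fqx q) (z w : ℂ) (P : Fqx q) : ℂ :=
  if P ∣ l then
    (1 - w ^ P.natDegree) ^ 3 *
      (1 + ∑' i : ℕ, w ^ ((i + 1) * P.natDegree) * (dk q 3 (P ^ (i + 1)) : ℂ) *
        gSum q (l ^ 2) (P ^ (i + 1)) /
          ((Real.sqrt ((q : ℝ) ^ ((i + 1) * P.natDegree)) : ℂ) *
            (1 - 1 / (nm q P ^ 2 * z ^ P.natDegree))))
  else
    1 + 3 * w ^ P.natDegree / (nm q P ^ 2 * z ^ P.natDegree - 1)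
      + 3 * w ^ (2 * P.natDegree)
      - 9 * w ^ (2 * P.natDegree) / (1 - 1 / (nm q P ^ 2 * z ^ P.natDegree))
      - w ^ (3 * P.natDegree)
      + 9 * w ^ (3 * P.natDegree) / (1 - 1 / (nm q P ^ 2 * z ^ P.natDegree))
      - 3 * w ^ (4 * P.natDegree) / (1 - 1 / (nm q P ^ 2 * z ^ P.natDegree))

/-- `C(z, w) = ∑_{l ∈ M} z^(deg l) ∏_P A_P(l²; z, w)`. -/
def Cser (q : ℕ) [Fact q.Prime] (z w : ℂ) : ℂ :=
  ∑' l : {l : Fqx q // l.Monic}, z ^ l.1.natDegree * ∏' P : MIrr q, APf q l.1 z w P.1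

/-- The local factor `H_P(z, w)`. -/
def HPf (q : ℕ) (z w : ℂ) (P : Fqx q) : ℂ :=
  (1 - w ^ P.natDegree) ^ 3 * (1 - nm q P * (w ^ 2 * z) ^ P.natDegree) ^ 3 *
    (1 + (w * z) ^ P.natDegree) ^ 3 *
    (1 + 3 * w ^ P.natDegree + 3 * nm q P * (z * w ^ 2) ^ P.natDegree
      + 3 * w ^ (2 * P.natDegree) / nm q P - 3 * (z * w) ^ P.natDegree
      - 1 / (nm q P ^ 2 * z ^ P.natDegree) - 6 * (z * w ^ 2) ^ P.natDegree
      + nm q P * (z * w ^ 3) ^ P.natDegree - 3 * (z * w ^ 4) ^ P.natDegree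
      - nm q P * (z ^ 2 * w ^ 3) ^ P.natDegree + 3 * nm q P * (z ^ 2 * w ^ 4) ^ P.natDegree
      + nm q P * (z ^ 2 * w ^ 6) ^ P.natDegree - nm q P ^ 2 * (z ^ 3 * w ^ 6) ^ P.natDegree)

/-- `H(z, w) = ∏_P H_P(z, w)`. -/
def Hfull (q : ℕ) (z w : ℂ) : ℂ := ∏' P : MIrr q, HPf q z w P.1

end

open scoped Classical in
/-- The finite set of monic polynomials of degree `n`. -/
noncomputable def monicFinset (q : ℕ) [NeZero q] (n : ℕ) : Finset (Fqx q) :=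
  Finset.univ.image (monicOf q n)

/-- `C ∣ f^∞`: every monic irreducible factor of `C` divides `f`. -/
def FactorsDivide {q : ℕ} (f Cd : Fqx q) : Prop :=
  ∀ P : Fqx q, P.Monic → Irreducible P → P ∣ Cd → P ∣ f

section

variable {q : ℕ}

open scoped Classical in
lemma legSym_sq (f P : Fqx q) : legSym q f P ^ 2 = if P ∣ f then 0 else 1 := by
  unfold legSym
  split_ifs <;> simp

open scoped Classical in
lemma legSym_of_associated (f : Fqx q) {P Q : Fqx q} (h : Associated P Q) :
    legSym q f P = legSym q f Q := by
  have hdvd : ∀ g : Fqx q, P ∣ g ↔ Q ∣ g := fun g => h.dvd_iff_dvd_left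
  exact if_ctx_congr (hdvd f) (fun _ => rfl) fun _ =>
    if_ctx_congr (exists_congr fun g => hdvd _) (fun _ => rfl) fun _ => rfl

lemma polyOf_degree_lt (n : ℕ) (c : Fin n → ZMod q) : (polyOf q n c).degree < n := by
  unfold polyOf
  rw [← Polynomial.mem_degreeLT]
  refine Submodule.sum_mem _ fun i _ => ?_
  rw [Polynomial.mem_degreeLT]
  exact (degree_C_mul_X_pow_le _ _).trans_lt (by exact_mod_cast i.2)

lemma polyOf_coeff (n : ℕ) (c : Fin n → ZMod q) (i : Fin n) : (polyOf q n c).coeff i = c i := by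
  simp only [polyOf, finsetSum_coeff, coeff_C_mul, coeff_X_pow]
  rw [Finset.sum_eq_single i]
  · simp
  · intro b _ hb
    rw [if_neg (fun h => hb (Fin.ext h.symm)), mul_zero]
  · simp

lemma monicOf_injective (n : ℕ) : Function.Injective (monicOf q n) := by
  intro c c' h
  have h' : polyOf q n c = polyOf q n c' := add_left_cancel h
  funext i
  rw [← polyOf_coeff n c i, h', polyOf_coeff]

variable [Fact q.Prime]

lemma mem_monicFinset {n : ℕ} {h : Fqx q} :
    h ∈ monicFinset q n ↔ h.Monic ∧ h.natDegree = n := by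
  simp only [monicFinset, Finset.mem_image, Finset.mem_univ, true_and]
  constructor
  · rintro ⟨c, rfl⟩
    have hm : (monicOf q n c).degree = (n : WithBot ℕ) := by
      change (X ^ n + polyOf q n c).degree = (n : WithBot ℕ)
      rw [degree_add_eq_left_of_degree_lt, degree_X_pow]
      simpa using polyOf_degree_lt n c
    exact ⟨monic_X_pow_add (polyOf_degree_lt n c), natDegree_eq_of_degree_eq_some hm⟩
  · rintro ⟨hm, rfl⟩
    refine ⟨fun i => h.coeff i, ?_⟩
    conv_rhs => rw [hm.as_sum]
    rw [monicOf, Fin.sum_univ_eq_sum_range (fun i => C (h.coeff i) * X ^ i)]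

lemma card_monicFinset (n : ℕ) : (monicFinset q n).card = q ^ n := by
  classical
  rw [monicFinset, Finset.card_image_of_injective _ (monicOf_injective n)]
  simp [ZMod.card]

lemma sumMn_natCast (n : ℕ) (F : Fqx q → ℂ) :
    sumMn q n F = ∑ h ∈ monicFinset q n, F h := by
  classical
  rw [monicFinset, Finset.sum_image fun _ _ _ _ h => monicOf_injective n h]
  simp [sumMn]

lemma sumMn_of_neg {n : ℤ} (hn : n < 0) (F : Fqx q → ℂ) : sumMn q n F = 0 := by
  rw [sumMn, if_neg (not_le.mpr hn)]

open scoped Classical in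
lemma sumH_eq_sum (n : ℕ) (F : Fqx q → ℂ) :
    sumH q n F = ∑ h ∈ monicFinset q n with Squarefree h, F h := by
  rw [Finset.sum_filter, monicFinset, Finset.sum_image fun _ _ _ _ h => monicOf_injective n h]
  unfold sumH
  congr!

open scoped Classical in
lemma jacSym_eq_normalizedFactors (f : Fqx q) {u : Fqx q} (hu : u ≠ 0) :
    jacSym q f u =
      ((UniqueFactorizationMonoid.normalizedFactors u).map fun P => legSym q f P).prod := by
  rw [jacSym, if_neg hu, UniqueFactorizationMonoid.normalizedFactors, Multiset.map_map]
  congr 1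
  exact Multiset.map_congr rfl fun P _ => legSym_of_associated f (associated_normalize P)

lemma chi_mul (f : Fqx q) {u v : Fqx q} (hu : u ≠ 0) (hv : v ≠ 0) :
    chi q f (u * v) = chi q f u * chi q f v := by
  classical
  simp only [chi]
  rw [jacSym_eq_normalizedFactors f hu, jacSym_eq_normalizedFactors f hv,
    jacSym_eq_normalizedFactors f (mul_ne_zero hu hv),
    UniqueFactorizationMonoid.normalizedFactors_mul hu hv, Multiset.map_add, Multiset.prod_add,
    Int.cast_mul]

open scoped Classical in
lemma chi_sq (f : Fqx q) {u : Fqx q} (hu : u ≠ 0) :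
    chi q f u ^ 2 = if IsCoprime u f then 1 else 0 := by
  have key : jacSym q f u ^ 2 = if IsCoprime u f then 1 else 0 := by
    rw [jacSym_eq_normalizedFactors f hu, ← Multiset.prod_map_pow]
    simp only [legSym_sq]
    split_ifs with h
    · refine Multiset.prod_eq_one ?_
      intro x hx
      obtain ⟨P, hP, rfl⟩ := Multiset.mem_map.mp hx
      rw [if_neg]
      exact fun hPf => (UniqueFactorizationMonoid.irreducible_of_normalized_factor P hP).not_isUnit
        (h.isUnit_of_dvd' (UniqueFactorizationMonoid.dvd_of_mem_normalizedFactors hP) hPf)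
    · have : ∃ P : Fqx q, Irreducible P ∧ P ∣ u ∧ P ∣ f := by
        by_contra! hn
        exact h (isCoprime_of_irreducible_dvd (fun h0 => hu h0.1) fun P hP => hn P hP)
      obtain ⟨P, hP, hPu, hPf⟩ := this
      obtain ⟨Q, hQ, hPQ⟩ :=
        UniqueFactorizationMonoid.exists_mem_normalizedFactors_of_dvd hu hP hPu
      refine Multiset.prod_eq_zero (Multiset.mem_map.mpr ⟨Q, hQ, ?_⟩)
      rw [if_pos (hPQ.dvd_iff_dvd_left.mp hPf)]
  rw [chi]
  exact_mod_cast congrArg (Int.cast : ℤ → ℂ) key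

lemma exists_monic_irreducible_dvd {u : Fqx q} (hu : ¬ IsUnit u) (hu0 : u ≠ 0) :
    ∃ P : Fqx q, P.Monic ∧ Irreducible P ∧ P ∣ u := by
  classical
  obtain ⟨P, hP, hPu⟩ := WfDvdMonoid.exists_irreducible_factor hu hu0
  exact ⟨normalize P, monic_normalize hP.ne_zero,
    (associated_normalize P).irreducible hP, (normalize_dvd_iff).mpr hPu⟩

lemma exists_squarefree_mul_sq (n : ℕ) : ∀ h : Fqx q, h.Monic → h.natDegree = n →
    ∃ D l : Fqx q, D.Monic ∧ Squarefree D ∧ l.Monic ∧ D * l ^ 2 = h := by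
  induction n using Nat.strong_induction_on with
  | _ n ih =>
    intro h hm hn
    by_cases hs : Squarefree h
    · exact ⟨h, 1, hm, hs, monic_one, by simp⟩
    · simp only [Squarefree, not_forall] at hs
      obtain ⟨x, hx, hxu⟩ := hs
      have hx0 : x ≠ 0 := by
        rintro rfl
        exact hm.ne_zero (by simpa using hx)
      obtain ⟨P, hPm, hP, hPx⟩ := exists_monic_irreducible_dvd hxu hx0
      obtain ⟨k, rfl⟩ := (mul_dvd_mul hPx hPx).trans hx
      have hk : k.Monic := (hPm.mul hPm).of_mul_monic_left hm
      have hd := hP.natDegree_pos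
      rw [(hPm.mul hPm).natDegree_mul hk, hPm.natDegree_mul hPm] at hn
      obtain ⟨D, l, hD, hDs, hl, rfl⟩ := ih k.natDegree (by omega) k hk rfl
      exact ⟨D, P * l, hD, hDs, hPm.mul hl, by ring⟩

lemma squarefree_mul_sq_inj {D l D' l' : Fqx q} (hD : D.Monic) (hDs : Squarefree D)
    (hl : l.Monic) (hD' : D'.Monic) (hDs' : Squarefree D') (hl' : l'.Monic)
    (h : D * l ^ 2 = D' * l' ^ 2) : D = D' ∧ l = l' := by
  classical
  have hll : l = l' := by
    refine eq_of_monic_of_associated hl hl' ?_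
    rw [UniqueFactorizationMonoid.associated_iff_normalizedFactors_eq_normalizedFactors
      hl.ne_zero hl'.ne_zero]
    ext P
    have h1 := congrArg (fun u => (UniqueFactorizationMonoid.normalizedFactors u).count P) h
    simp only [UniqueFactorizationMonoid.normalizedFactors_mul hD.ne_zero (hl.pow 2).ne_zero,
      UniqueFactorizationMonoid.normalizedFactors_mul hD'.ne_zero (hl'.pow 2).ne_zero,
      UniqueFactorizationMonoid.normalizedFactors_pow, Multiset.count_add,
      Multiset.count_nsmul] at h1
    have h2 := Multiset.nodup_iff_count_le_one.mp
      ((UniqueFactorizationMonoid.squarefree_iff_nodup_normalizedFactors hD.ne_zero).mp hDs) P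
    have h3 := Multiset.nodup_iff_count_le_one.mp
      ((UniqueFactorizationMonoid.squarefree_iff_nodup_normalizedFactors hD'.ne_zero).mp hDs') P
    omega
  subst hll
  exact ⟨mul_right_cancel₀ (hl.pow 2).ne_zero h, rfl⟩

lemma exists_factorsDivide_mul_coprime {f : Fqx q} (n : ℕ) :
    ∀ h : Fqx q, h.Monic → h.natDegree = n →
    ∃ Cd l : Fqx q, Cd.Monic ∧ FactorsDivide f Cd ∧ l.Monic ∧ IsCoprime l f ∧ Cd * l = h := by
  induction n using Nat.strong_induction_on with
  | _ n ih =>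
    intro h hm hn
    by_cases hs : IsCoprime h f
    · refine ⟨1, h, monic_one, fun P _ hP hP1 => ?_, hm, hs, one_mul h⟩
      exact absurd (isUnit_of_dvd_one hP1) hP.not_isUnit
    · have : ∃ x : Fqx q, Irreducible x ∧ x ∣ h ∧ x ∣ f := by
        by_contra! hc
        exact hs (isCoprime_of_irreducible_dvd (fun h0 => hm.ne_zero h0.1) fun P hP => hc P hP)
      obtain ⟨x, hx, hxh, hxf⟩ := this
      obtain ⟨P, hPm, hP, hPx⟩ := exists_monic_irreducible_dvd hx.not_isUnit hx.ne_zero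
      obtain ⟨k, rfl⟩ := hPx.trans hxh
      have hk : k.Monic := hPm.of_mul_monic_left hm
      have hd := hP.natDegree_pos
      rw [hPm.natDegree_mul hk] at hn
      obtain ⟨D, l, hD, hDf, hl, hlf, rfl⟩ := ih k.natDegree (by omega) k hk rfl
      refine ⟨P * D, l, hPm.mul hD, fun Q hQm hQ hQd => ?_, hl, hlf, by ring⟩
      rcases hQ.prime.dvd_or_dvd hQd with h1 | h1
      · exact h1.trans (hPx.trans hxf)
      · exact hDf Q hQm hQ h1

lemma FactorsDivide.isCoprime {f Cd l : Fqx q} (hC : Cd ≠ 0) (h : FactorsDivide f Cd)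
    (hl : IsCoprime l f) : IsCoprime Cd l := by
  refine isCoprime_of_irreducible_dvd (fun h0 => hC h0.1) fun x hx hxC hxl => ?_
  obtain ⟨P, hPm, hP, hPx⟩ := exists_monic_irreducible_dvd hx.not_isUnit hx.ne_zero
  exact hP.not_isUnit (hl.isUnit_of_dvd' (hPx.trans hxl) (h P hPm hP (hPx.trans hxC)))

lemma factorsDivide_mul_coprime_inj {f C₁ l₁ C₂ l₂ : Fqx q} (hC₁ : C₁.Monic)
    (hf₁ : FactorsDivide f C₁) (hl₁ : IsCoprime l₁ f) (hC₂ : C₂.Monic)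
    (hf₂ : FactorsDivide f C₂) (hl₂ : IsCoprime l₂ f) (h : C₁ * l₁ = C₂ * l₂) :
    C₁ = C₂ ∧ l₁ = l₂ := by
  have h12 : C₁ ∣ C₂ :=
    (hf₁.isCoprime hC₁.ne_zero hl₂).dvd_of_dvd_mul_right (h ▸ dvd_mul_right C₁ l₁)
  have h21 : C₂ ∣ C₁ :=
    (hf₂.isCoprime hC₂.ne_zero hl₁).dvd_of_dvd_mul_right (h ▸ dvd_mul_right C₂ l₂)
  have hC : C₁ = C₂ := eq_of_monic_of_associated hC₁ hC₂ (associated_of_dvd_dvd h12 h21)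
  subst hC
  exact ⟨rfl, mul_left_cancel₀ hC₁.ne_zero h⟩

end

/-- A sum over a set whose elements factor uniquely as `m x y`, with `x` and `y` in graded sets,
is a convolution. -/
lemma Finset.sum_eq_sum_antidiagonal_of_factorization {α : Type*} {A B : ℕ → Finset α}
    {N : Finset α} {n : ℕ} (m : α → α → α)
    (hA : ∀ {i j x}, x ∈ A i → x ∈ A j → i = j)
    (hmem : ∀ {i j x y}, i + j = n → x ∈ A i → y ∈ B j → m x y ∈ N)
    (hinj : ∀ {i j i' j' x y x' y'}, x ∈ A i → y ∈ B j → x' ∈ A i' → y' ∈ B j' →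
      m x y = m x' y' → x = x' ∧ y = y')
    (hsurj : ∀ z ∈ N, ∃ i j x y, i + j = n ∧ x ∈ A i ∧ y ∈ B j ∧ m x y = z)
    (F : α → ℂ) :
    ∑ z ∈ N, F z = ∑ p ∈ Finset.HasAntidiagonal.antidiagonal n, ∑ x ∈ A p.1, ∑ y ∈ B p.2, F (m x y) := by
  simp_rw [← Finset.sum_product']
  rw [Finset.sum_sigma']
  symm
  refine Finset.sum_bij (fun s _ => m s.2.1 s.2.2) ?_ ?_ ?_ fun _ _ => rfl
  · rintro ⟨⟨i, j⟩, x, y⟩ hs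
    simp only [Finset.mem_sigma, Finset.HasAntidiagonal.mem_antidiagonal, Finset.mem_product] at hs
    exact hmem hs.1 hs.2.1 hs.2.2
  · rintro ⟨⟨i, j⟩, x, y⟩ hs ⟨⟨i', j'⟩, x', y'⟩ hs' h
    simp only [Finset.mem_sigma, Finset.HasAntidiagonal.mem_antidiagonal, Finset.mem_product] at hs hs'
    obtain ⟨rfl, rfl⟩ := hinj hs.2.1 hs.2.2 hs'.2.1 hs'.2.2 h
    obtain rfl := hA hs.2.1 hs'.2.1
    obtain rfl : j = j' := by omega
    rfl
  · intro z hz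
    obtain ⟨i, j, x, y, hij, hx, hy, rfl⟩ := hsurj z hz
    exact ⟨⟨(i, j), x, y⟩, by simp [hij, hx, hy], rfl⟩

section

variable {q : ℕ} [Fact q.Prime]

open scoped Classical in
/-- The generating series of the monic polynomials `C` with `C ∣ f^∞`. -/
noncomputable def factorsDivideSeries (f : Fqx q) : PowerSeries ℂ :=
  PowerSeries.mk fun n => ((monicFinset q n).filter (FactorsDivide f)).card

open scoped Classical in
/-- The generating series of the monic polynomials coprime to `f`. -/
noncomputable def coprimeSeries (f : Fqx q) : PowerSeries ℂ :=
  PowerSeries.mk fun n => ((monicFinset q n).filter (IsCoprime · f)).card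

/-- The generating series of the character sums over monic polynomials of odd degree. -/
noncomputable def oddCharSeries (f : Fqx q) : PowerSeries ℂ :=
  PowerSeries.mk fun n => ∑ h ∈ monicFinset q (2 * n + 1), chi q f h

/-- The generating series of the character sums over monic squarefree polynomials of odd
degree. -/
noncomputable def oddSquarefreeCharSeries (f : Fqx q) : PowerSeries ℂ :=
  PowerSeries.mk fun n => sumH q (2 * n + 1) fun h => chi q f h

lemma factorsDivideSeries_mul_coprimeSeries (f : Fqx q) :
    factorsDivideSeries f * coprimeSeries f = PowerSeries.mk fun n => (q : ℂ) ^ n := by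
  classical
  ext n
  rw [PowerSeries.coeff_mul, PowerSeries.coeff_mk]
  have key := Finset.sum_eq_sum_antidiagonal_of_factorization
    (A := fun n => (monicFinset q n).filter (FactorsDivide f))
    (B := fun n => (monicFinset q n).filter (IsCoprime · f)) (N := monicFinset q n) (n := n)
    (· * ·) ?_ ?_ ?_ ?_ (fun _ => 1)
  · simp only [Finset.sum_const, card_monicFinset, nsmul_eq_mul, mul_one, Nat.cast_pow] at key
    simpa [factorsDivideSeries, coprimeSeries] using key.symm
  · intro i j x hx hy
    simp only [Finset.mem_filter, mem_monicFinset] at hx hy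
    exact hx.1.2.symm.trans hy.1.2
  · intro i j x y hij hx hy
    simp only [Finset.mem_filter, mem_monicFinset] at hx hy ⊢
    exact ⟨hx.1.1.mul hy.1.1, by rw [hx.1.1.natDegree_mul hy.1.1]; omega⟩
  · intro i j i' j' x y x' y' hx hy hx' hy' h
    simp only [Finset.mem_filter, mem_monicFinset] at hx hy hx' hy'
    exact factorsDivide_mul_coprime_inj hx.1.1 hx.2 hy.2 hx'.1.1 hx'.2 hy'.2 h
  · intro z hz
    rw [mem_monicFinset] at hz
    obtain ⟨x, y, hx, hxf, hy, hyf, rfl⟩ := exists_factorsDivide_mul_coprime (f := f) n z hz.1 hz.2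
    refine ⟨x.natDegree, y.natDegree, x, y, ?_, ?_, ?_, rfl⟩
    · rw [← hx.natDegree_mul hy, hz.2]
    · simp [mem_monicFinset, hx, hxf]
    · simp [mem_monicFinset, hy, hyf]

lemma oddSquarefreeCharSeries_mul_coprimeSeries (f : Fqx q) :
    oddSquarefreeCharSeries f * coprimeSeries f = oddCharSeries f := by
  classical
  ext n
  rw [PowerSeries.coeff_mul, oddCharSeries, PowerSeries.coeff_mk]
  have key := Finset.sum_eq_sum_antidiagonal_of_factorization
    (A := fun n => (monicFinset q (2 * n + 1)).filter Squarefree)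
    (B := fun n => monicFinset q n) (N := monicFinset q (2 * n + 1)) (n := n)
    (fun x y => x * y ^ 2) ?_ ?_ ?_ ?_ (fun h => chi q f h)
  · rw [key]
    refine Finset.sum_congr rfl fun p _ => ?_
    simp only [oddSquarefreeCharSeries, coprimeSeries, PowerSeries.coeff_mk, sumH_eq_sum]
    rw [Finset.sum_mul]
    refine Finset.sum_congr rfl fun x hx => ?_
    rw [Finset.card_filter, Nat.cast_sum, Finset.mul_sum]
    refine Finset.sum_congr rfl fun y hy => ?_
    simp only [Finset.mem_filter, mem_monicFinset] at hx hy
    rw [chi_mul f hx.1.1.ne_zero (hy.1.pow 2).ne_zero, sq, chi_mul f hy.1.ne_zero hy.1.ne_zero,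
      ← sq, chi_sq f hy.1.ne_zero]
    simp
  · intro i j x hx hy
    simp only [Finset.mem_filter, mem_monicFinset] at hx hy
    omega
  · intro i j x y hij hx hy
    simp only [Finset.mem_filter, mem_monicFinset] at hx hy ⊢
    refine ⟨hx.1.1.mul (hy.1.pow 2), ?_⟩
    rw [hx.1.1.natDegree_mul (hy.1.pow 2), hy.1.natDegree_pow]
    omega
  · intro i j i' j' x y x' y' hx hy hx' hy' h
    simp only [Finset.mem_filter, mem_monicFinset] at hx hy hx' hy'
    exact squarefree_mul_sq_inj hx.1.1 hx.2 hy.1 hx'.1.1 hx'.2 hy'.1 h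
  · intro z hz
    rw [mem_monicFinset] at hz
    obtain ⟨x, y, hx, hxs, hy, rfl⟩ := exists_squarefree_mul_sq _ z hz.1 rfl
    have hd := hz.2
    rw [hx.natDegree_mul (hy.pow 2), hy.natDegree_pow] at hd
    refine ⟨n - y.natDegree, y.natDegree, x, y, by omega, ?_, ?_, rfl⟩
    · simp only [Finset.mem_filter, mem_monicFinset]
      exact ⟨⟨hx, by omega⟩, hxs⟩
    · simp [mem_monicFinset, hy]

lemma tsum_factorsDivide_eq_coeff (f : Fqx q) (n : ℕ) :
    (∑' Cd : {Cd : Fqx q // Cd.Monic ∧ FactorsDivide f Cd},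
        sumMn q (2 * (n : ℤ) + 1 - 2 * Cd.1.natDegree) (fun h => chi q f h)) =
      PowerSeries.coeff n (factorsDivideSeries f * oddCharSeries f) := by
  classical
  set G : Fqx q → ℂ := fun Cd =>
    sumMn q (2 * (n : ℤ) + 1 - 2 * Cd.natDegree) (fun h => chi q f h) with hG
  set U : Finset (Fqx q) :=
    ((Finset.range (n + 1)).biUnion (monicFinset q)).filter (FactorsDivide f) with hU
  have hUmem : ∀ x, x ∈ U ↔ (x.Monic ∧ FactorsDivide f x) ∧ x.natDegree ≤ n := by
    intro x
    simp only [hU, Finset.mem_filter, Finset.mem_biUnion, Finset.mem_range, mem_monicFinset]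
    constructor
    · rintro ⟨⟨i, hi, hm, rfl⟩, hf⟩
      exact ⟨⟨hm, hf⟩, by omega⟩
    · rintro ⟨⟨hm, hf⟩, hd⟩
      exact ⟨⟨_, by omega, hm, rfl⟩, hf⟩
  have h1 : (∑' Cd : {Cd : Fqx q // Cd.Monic ∧ FactorsDivide f Cd}, G Cd.1) = ∑ x ∈ U, G x := by
    rw [show (∑' Cd : {Cd : Fqx q // Cd.Monic ∧ FactorsDivide f Cd}, G Cd.1) =
      ∑' x, Set.indicator {Cd : Fqx q | Cd.Monic ∧ FactorsDivide f Cd} G x from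
        tsum_subtype {Cd : Fqx q | Cd.Monic ∧ FactorsDivide f Cd} G, tsum_eq_sum (s := U)]
    · refine Finset.sum_congr rfl fun x hx => ?_
      rw [Set.indicator_of_mem (show x ∈ {Cd : Fqx q | Cd.Monic ∧ FactorsDivide f Cd} from
        ((hUmem x).mp hx).1)]
    · intro x hx
      by_cases hxm : x ∈ {Cd : Fqx q | Cd.Monic ∧ FactorsDivide f Cd}
      · rw [Set.indicator_of_mem hxm]
        have : ¬ x.natDegree ≤ n := fun hd => hx ((hUmem x).mpr ⟨hxm, hd⟩)
        exact sumMn_of_neg (by omega) _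
      · exact Set.indicator_of_notMem hxm G
  rw [h1, PowerSeries.coeff_mul, Finset.Nat.sum_antidiagonal_eq_sum_range_succ_mk,
    ← Finset.sum_fiberwise_of_maps_to (s := U) (t := Finset.range n.succ)
      (g := fun x => x.natDegree) (fun x hx => Finset.mem_range.mpr
        (Nat.lt_succ_of_le ((hUmem x).mp hx).2))]
  refine Finset.sum_congr rfl fun i hi => ?_
  have hi' : i ≤ n := Nat.lt_succ_iff.mp (Finset.mem_range.mp hi)
  have h2 : U.filter (fun x => x.natDegree = i) = (monicFinset q i).filter (FactorsDivide f) := by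
    ext x
    simp only [Finset.mem_filter, hUmem, mem_monicFinset]
    constructor
    · rintro ⟨⟨⟨hm, hf⟩, -⟩, rfl⟩
      exact ⟨⟨hm, rfl⟩, hf⟩
    · rintro ⟨⟨hm, rfl⟩, hf⟩
      exact ⟨⟨⟨hm, hf⟩, hi'⟩, rfl⟩
  rw [h2]
  simp only [factorsDivideSeries, oddCharSeries, PowerSeries.coeff_mk]
  rw [← nsmul_eq_mul, ← Finset.sum_const]
  refine Finset.sum_congr rfl fun x hx => ?_
  simp only [Finset.mem_filter, mem_monicFinset] at hx
  rw [← sumMn_natCast]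
  change sumMn q _ _ = _
  congr 1
  have := hx.1.2
  push_cast [Nat.cast_sub hi']
  omega

end

/-- for `f` monic,
`∑_{D ∈ H_{2g+1}} χ_f(D) = ∑_{C | f^∞} ∑_{h ∈ M_{2g+1-2 deg C}} χ_f(h)
  - q ∑_{C | f^∞} ∑_{h ∈ M_{2g-1-2 deg C}} χ_f(h)`,
where `C` runs over the monic polynomials all of whose monic irreducible factors
divide `f`. -/
theorem char_sum_over_squarefree (q : ℕ) [Fact q.Prime] (hq4 : q % 4 = 1) (g : ℕ)
    (f : Fqx q) (hf : f.Monic) :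
    sumH q (2 * g + 1) (fun D => chi q f D) =
      (∑' Cd : {Cd : Fqx q // Cd.Monic ∧
          ∀ P : Fqx q, P.Monic → Irreducible P → P ∣ Cd → P ∣ f},
        sumMn q (2 * (g : ℤ) + 1 - 2 * Cd.1.natDegree) (fun h => chi q f h)) -
      q * ∑' Cd : {Cd : Fqx q // Cd.Monic ∧
          ∀ P : Fqx q, P.Monic → Irreducible P → P ∣ Cd → P ∣ f},
        sumMn q (2 * (g : ℤ) - 1 - 2 * Cd.1.natDegree) (fun h => chi q f h) := by
  have hseries : factorsDivideSeries f * oddCharSeries f =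
      oddSquarefreeCharSeries f * PowerSeries.mk fun n => (q : ℂ) ^ n := by
    rw [← oddSquarefreeCharSeries_mul_coprimeSeries, ← factorsDivideSeries_mul_coprimeSeries f]
    ring
  have hgeom : (PowerSeries.mk fun n => (q : ℂ) ^ n) =
      1 + PowerSeries.C (q : ℂ) * ((PowerSeries.mk fun n => (q : ℂ) ^ n) * PowerSeries.X) := by
    ext n
    cases n with
    | zero => simp
    | succ n =>
      rw [map_add, PowerSeries.coeff_C_mul, PowerSeries.coeff_succ_mul_X]
      simp [pow_succ', PowerSeries.coeff_one]
  have hrec : oddSquarefreeCharSeries f = factorsDivideSeries f * oddCharSeries f -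
      PowerSeries.C (q : ℂ) * ((factorsDivideSeries f * oddCharSeries f) * PowerSeries.X) := by
    rw [hseries]
    linear_combination (- oddSquarefreeCharSeries f) * hgeom
  have hcoeff := congrArg (PowerSeries.coeff g) hrec
  rw [map_sub, PowerSeries.coeff_C_mul] at hcoeff
  rw [show sumH q (2 * g + 1) (fun D => chi q f D) =
    PowerSeries.coeff g (oddSquarefreeCharSeries f) by simp [oddSquarefreeCharSeries], hcoeff]
  congr 1
  · exact (tsum_factorsDivide_eq_coeff f g).symm
  congr 1
  cases g with
  | zero =>
    rw [PowerSeries.coeff_zero_mul_X]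
    symm
    convert tsum_zero with Cd
    exact sumMn_of_neg (by omega) _
  | succ g =>
    rw [PowerSeries.coeff_succ_mul_X, ← tsum_factorsDivide_eq_coeff]
    refine tsum_congr fun Cd => ?_
    congr 1
    push_cast
    ring
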